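/- Let a, b ∈ ℂ with a ≠ b and let q ∈ ℂ[z] be a nonzero polynomial. For f ∈ ℂ[z], define ∫_a^b f(z) dz := F(b) − F(a), where F is any antiderivative of f in ℂ[z] (i.e., F' = f). Regard ℂ[z] as a module over itself and set N_q := {f ∈ ℂ[z] | ∫_a^b f(z) q(z) dz = 0}. Then σ(N_q) = {0} and τ(N_q) = (ℂ[z] \ N_q) ∪ {0}. -/

import Mathlib

/-- `J` is a (two-sided) Mathieu subspace of the `K`-algebra `A`. -/
def IsMathieuSubspace {K A : Type*} [Field K] [Ring A] [Algebra K A]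
    (J : Submodule K A) : Prop :=
  ∀ a : A, (∀ m : ℕ, 1 ≤ m → a ^ m ∈ J) →
    ∀ b c : A, ∃ N : ℕ, 1 ≤ N ∧ ∀ m : ℕ, N ≤ m → b * a ^ m * c ∈ J

/-- A `K`-subspace `J` of `A` is a two-sided ideal of `A` if it absorbs
multiplication on both sides. -/
def IsTwoSidedIdealSubspace {K A : Type*} [Field K] [Ring A] [Algebra K A]
    (J : Submodule K A) : Prop :=
  ∀ a ∈ J, ∀ b : A, b * a ∈ J ∧ a * b ∈ J

variable {K A M : Type*} [Field K] [Ring A] [Algebra K A] [AddCommGroup M]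
  [Module A M] [Module K M] [IsScalarTower K A M]

/-- For `u ∈ M` and a `K`-subspace `N` of `M`, the `K`-subspace
`(N : u) = {a ∈ A | a • u ∈ N}` of `A`. -/
def colonSub (N : Submodule K M) (u : M) : Submodule K A where
  carrier := {a : A | a • u ∈ N}
  add_mem' := by
    intro a b ha hb
    simp only [Set.mem_setOf_eq, add_smul] at *
    exact N.add_mem ha hb
  zero_mem' := by
    simp only [Set.mem_setOf_eq, zero_smul]
    exact N.zero_mem
  smul_mem' := by
    intro r a ha
    simp only [Set.mem_setOf_eq] at *
    rw [smul_assoc]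
    exact N.smul_mem r ha

/-- The set of stable elements of `N`. -/
def sigmaSet (N : Submodule K M) : Set M :=
  {u : M | IsTwoSidedIdealSubspace (colonSub (A := A) N u)}

/-- The set of quasi-stable elements of `N`. -/
def tauSet (N : Submodule K M) : Set M :=
  {u : M | IsMathieuSubspace (colonSub (A := A) N u)}

/-- The ℂ-subspace `N_q = {f ∈ ℂ[z] | ∫_a^b f(z)q(z) dz = 0}` of `ℂ[z]`, where the
integral is defined as `F(b) - F(a)` for an antiderivative `F` of `f * q`. -/
noncomputable def Nq (a b : ℂ) (q : Polynomial ℂ) : Submodule ℂ (Polynomial ℂ) where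
  carrier := {f : Polynomial ℂ |
    ∃ F : Polynomial ℂ, F.derivative = f * q ∧ F.eval b - F.eval a = 0}
  zero_mem' := ⟨0, by simp⟩
  add_mem' := by
    rintro f g ⟨F, hF, hFe⟩ ⟨G, hG, hGe⟩
    refine ⟨F + G, ?_, ?_⟩
    · rw [Polynomial.derivative_add, hF, hG, add_mul]
    · simp only [Polynomial.eval_add]
      linear_combination hFe + hGe
  smul_mem' := by
    rintro c f ⟨F, hF, hFe⟩
    refine ⟨c • F, ?_, ?_⟩
    · rw [Polynomial.derivative_smul, hF, smul_mul_assoc]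
    · simp only [Polynomial.eval_smul, smul_eq_mul]
      linear_combination c * hFe

open Polynomial Filter Topology

/-- A continuous lift of an analytic curve through a locally invertible analytic function is
analytic. -/
theorem analyticAt_of_lift {g : ℂ → ℂ} {z w : ℝ → ℂ} {s : ℝ} (hz : ContinuousAt z s)
    (hgz : ∀ t, g (z t) = w t) (hw : AnalyticAt ℝ w s) (hg : AnalyticAt ℂ g (z s))
    (hg' : deriv g (z s) ≠ 0) : AnalyticAt ℝ z s := by
  have hinv := hg.analyticAt_localInverse hg'
  have hcomp : AnalyticAt ℝ
      (fun t ↦ hg.hasStrictDerivAt.localInverse _ _ _ hg' (w t)) s := by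
    have h := hinv.restrictScalars (𝕜 := ℝ)
    rw [hgz s] at h
    exact h.comp hw
  refine hcomp.congr ?_
  filter_upwards [hz.eventually (hg.hasStrictDerivAt.eventually_left_inverse hg')] with t ht
  rw [← hgz t]
  exact ht

theorem hasDerivAt_of_lift {g : ℂ → ℂ} {z w : ℝ → ℂ} {s : ℝ} {w' : ℂ} (hz : ContinuousAt z s)
    (hgz : ∀ t, g (z t) = w t) (hw : HasDerivAt w w' s) (hg : AnalyticAt ℂ g (z s))
    (hg' : deriv g (z s) ≠ 0) : HasDerivAt z ((deriv g (z s))⁻¹ * w') s := by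
  have hinv := (hg.hasStrictDerivAt.to_localInverse hg').hasDerivAt
  rw [hgz s] at hinv
  refine (hinv.scomp s hw |>.congr_deriv (by simp [mul_comm])).congr_of_eventuallyEq ?_
  filter_upwards [hz.eventually (hg.hasStrictDerivAt.eventually_left_inverse hg')] with t ht
  simp only [Function.comp_apply]
  rw [← hgz t]
  exact ht.symm

theorem analyticAt_ofReal_exp (s : ℝ) : AnalyticAt ℝ (fun t : ℝ ↦ Complex.exp t) s :=
  ((analyticAt_cexp (z := (s : ℂ))).restrictScalars (𝕜 := ℝ)).comp
    (Complex.ofRealCLM.analyticAt s)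

theorem hasDerivAt_ofReal_exp (s : ℝ) :
    HasDerivAt (fun t : ℝ ↦ Complex.exp t) (Complex.exp s) s :=
  (Complex.hasDerivAt_exp (s : ℂ)).comp_ofReal

/-- If the positive reals are regular values of `f`, the fibres of `f` over them are parametrized by
finitely many disjoint continuous curves. -/
theorem exists_branches {f : ℂ[X]} (hdeg : 0 < f.natDegree)
    (hf : ∀ z, f.derivative.eval z = 0 → ∀ s : ℝ, f.eval z ≠ Complex.exp s) :
    ∃ z : Fin f.natDegree → ℝ → ℂ, (∀ j, Continuous (z j)) ∧
      (∀ j s, f.eval (z j s) = Complex.exp s) ∧ ∀ s, Function.Injective fun j ↦ z j s := by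
  have hf1 : f - C 1 ≠ 0 := fun h ↦ by
    rw [sub_eq_zero] at h; rw [h] at hdeg; simp at hdeg
  have hd : (f - C 1).natDegree = f.natDegree := natDegree_sub_C
  have hnodup : (f - C 1).roots.Nodup := by
    rw [nodup_roots_iff_of_splits hf1 (IsAlgClosed.splits _)]
    rw [separable_def, isCoprime_iff_aeval_ne_zero_of_isAlgClosed ℂ ℂ]
    intro x
    by_contra! h
    simp only [coe_aeval_eq_eval, eval_sub, eval_C, derivative_sub, derivative_C, sub_zero] at h
    exact hf x h.2 0 (by simpa using sub_eq_zero.1 h.1)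
  have hcard : (f - C 1).roots.toFinset.card = f.natDegree := by
    rw [Multiset.toFinset_card_of_nodup hnodup, ← hd]
    exact (IsAlgClosed.splits _).natDegree_eq_card_roots.symm
  let e := (f - C 1).roots.toFinset.equivFinOfCardEq hcard
  have he (j) : f.eval (e.symm j : ℂ) = 1 := by
    have := (e.symm j).2
    simp only [Multiset.mem_toFinset, mem_roots hf1, IsRoot.def, eval_sub, eval_C] at this
    exact sub_eq_zero.1 this
  let w : C(ℝ, ℂ) := ⟨fun s ↦ Complex.exp s, by fun_prop⟩
  have hlift (s₀ : ℝ) (e₀ : ℂ) (h : f.eval e₀ = w s₀) :=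
    f.isCoveringMapOn_eval.existsUnique_continuousMap_lifts w h (fun s ⟨k, hk, hk'⟩ ↦ hf k hk s hk')
  choose z hz hz' using fun j ↦ (hlift 0 (e.symm j) (by simp [he, w])).exists
  have hzs (j s) : f.eval (z j s) = Complex.exp s := congrFun (hz' j) s
  refine ⟨fun j ↦ z j, fun j ↦ (z j).continuous, hzs, fun s i j hij ↦ ?_⟩
  have : z i = z j := (hlift s (z i s) (hzs i s)).unique ⟨rfl, hz' i⟩ ⟨hij.symm, hz' j⟩
  apply e.symm.injective
  apply Subtype.ext
  rw [← hz i, ← hz j, this]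

theorem exists_continuous_log {u : ℝ → ℂ} (hu : Continuous u) (hu0 : ∀ s, u s ≠ 0) (s₀ : ℝ) :
    ∃ l : ℝ → ℂ, Continuous l ∧ (∀ s, Complex.exp (l s) = u s) ∧ l s₀ = Complex.log (u s₀) := by
  obtain ⟨l, hl, hl'⟩ := (Complex.isCoveringMapOn_exp.existsUnique_continuousMap_lifts
    (⟨u, hu⟩ : C(ℝ, ℂ)) (a₀ := s₀) (Complex.exp_log (hu0 s₀)) (by simpa using hu0)).exists
  exact ⟨l, l.continuous, fun s ↦ congrFun hl' s, hl⟩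

theorem eventually_near_root {f : ℂ[X]} (hf : f ≠ 0) (ζ : ℂ) (hζ : f.eval ζ = 0) :
    (∀ᶠ z in 𝓝 ζ, ‖f.eval z‖ ≤ 2 * ‖f.derivative.eval z‖ * ‖z - ζ‖) ∧
    Tendsto (fun z ↦ ‖z - ζ‖ * Real.log ‖f.eval z‖) (𝓝 ζ) (𝓝 0) := by
  obtain ⟨h, hfh, hh⟩ := exists_eq_pow_rootMultiplicity_mul_and_not_dvd f hf ζ
  have hk : 0 < f.rootMultiplicity ζ := (rootMultiplicity_pos hf).2 hζ
  set k := f.rootMultiplicity ζ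
  rw [dvd_iff_isRoot, IsRoot.def] at hh
  have hev (z) : f.eval z = (z - ζ) ^ k * h.eval z := by rw [hfh]; simp
  have hder (z) : f.derivative.eval z * (z - ζ) =
      (z - ζ) ^ k * (k * h.eval z + (z - ζ) * h.derivative.eval z) := by
    obtain ⟨m, hm⟩ : ∃ m, k = m + 1 := ⟨k - 1, by omega⟩
    rw [hfh, hm]
    simp [derivative_mul, derivative_pow]
    ring
  constructor
  · have h1 : ContinuousAt
        (fun z ↦ 2 * ‖k * h.eval z + (z - ζ) * h.derivative.eval z‖ - ‖h.eval z‖) ζ := by fun_prop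
    have h2 : 0 < 2 * ‖k * h.eval ζ + (ζ - ζ) * h.derivative.eval ζ‖ - ‖h.eval ζ‖ := by
      have : 0 < ‖h.eval ζ‖ := norm_pos_iff.2 hh
      have hk' : (1 : ℝ) ≤ k := by exact_mod_cast hk
      simp
      nlinarith
    filter_upwards [h1.eventually (lt_mem_nhds h2)] with z hz
    rw [mul_assoc, ← norm_mul, hder, hev, norm_mul, norm_mul]
    nlinarith [norm_nonneg ((z - ζ) ^ k)]
  · have h1 : Tendsto (fun z ↦ k * (‖z - ζ‖ * Real.log ‖z - ζ‖) + ‖z - ζ‖ * Real.log ‖h.eval z‖)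
        (𝓝 ζ) (𝓝 0) := by
      have hc : ContinuousAt
          (fun z ↦ k * (‖z - ζ‖ * Real.log ‖z - ζ‖) + ‖z - ζ‖ * Real.log ‖h.eval z‖) ζ := by
        have a1 : ContinuousAt (fun z ↦ ‖z - ζ‖ * Real.log ‖z - ζ‖) ζ :=
          (Real.continuous_mul_log.comp (f := fun z ↦ ‖z - ζ‖) (by fun_prop)).continuousAt
        have a2 : ContinuousAt (fun z ↦ Real.log ‖h.eval z‖) ζ :=
          ContinuousAt.log (by fun_prop) (norm_ne_zero_iff.2 hh)
        exact (a1.const_mul _).add (ContinuousAt.mul (by fun_prop) a2)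
      simpa [ContinuousAt] using hc
    refine h1.congr' ?_
    have a3 : ∀ᶠ z in 𝓝 ζ, h.eval z ≠ 0 :=
      (h.continuous.continuousAt (x := ζ)).eventually_ne hh
    filter_upwards [a3] with z hz
    rcases eq_or_ne z ζ with rfl | hne
    · simp
    · rw [hev, norm_mul, norm_pow, Real.log_mul (by simp [sub_ne_zero.2 hne]) (by simpa using hz),
        Real.log_pow]
      ring

/-- Near the zero fibre, `f / f'` is dominated by the distance to any given point. -/
theorem eventually_fiber_le_dist {f : ℂ[X]} (hf : f ≠ 0) (c : ℂ) :
    ∀ᶠ w in 𝓝 (0 : ℂ), ∀ z, f.eval z = w →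
      ‖f.eval z‖ ≤ 2 * ‖f.derivative.eval z‖ * ‖z - c‖ := by
  refine f.isClosedMap_eval.eventually_nhds_fiber 0
    (p := fun z ↦ ‖f.eval z‖ ≤ 2 * ‖f.derivative.eval z‖ * ‖z - c‖) fun ζ hζ ↦ ?_
  have h := (eventually_near_root hf ζ hζ).1
  rcases eq_or_ne ζ c with rfl | hne
  · exact h
  have h1 : ContinuousAt (fun z ↦ ‖z - c‖ - ‖z - ζ‖) ζ := by fun_prop
  have h2 : 0 < ‖ζ - c‖ - ‖ζ - ζ‖ := by simpa [sub_eq_zero] using hne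
  filter_upwards [h, h1.eventually (lt_mem_nhds h2)] with z hz hz'
  exact hz.trans (by gcongr; linarith)

theorem eventually_fiber_log_le {f : ℂ[X]} (hf : f ≠ 0) (p : ℂ[X]) {ε : ℝ} (hε : 0 < ε) :
    ∀ᶠ w in 𝓝 (0 : ℂ), ∀ z, f.eval z = w →
      ‖p.eval z‖ * (‖f.eval z‖ * |Real.log ‖f.eval z‖|) ≤ ε * ‖f.derivative.eval z‖ := by
  refine f.isClosedMap_eval.eventually_nhds_fiber 0 (p := fun z ↦
    ‖p.eval z‖ * (‖f.eval z‖ * |Real.log ‖f.eval z‖|) ≤ ε * ‖f.derivative.eval z‖) fun ζ hζ ↦ ?_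
  obtain ⟨h, h'⟩ := eventually_near_root hf ζ hζ
  have hp : Tendsto (fun z ↦ ‖p.eval z‖) (𝓝 ζ) (𝓝 ‖p.eval ζ‖) :=
    (p.continuous.norm).continuousAt
  have h3 := (hp.mul h'.abs).eventually
    (gt_mem_nhds (show ‖p.eval ζ‖ * |(0 : ℝ)| < ε / 2 by simpa using hε))
  filter_upwards [h, h3] with z hz hz'
  rw [abs_mul, abs_norm] at hz'
  calc _ ≤ ‖p.eval z‖ * ((2 * ‖f.derivative.eval z‖ * ‖z - ζ‖) * |Real.log ‖f.eval z‖|) := by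
        gcongr
    _ = 2 * ‖f.derivative.eval z‖ * (‖p.eval z‖ * (‖z - ζ‖ * |Real.log ‖f.eval z‖|)) := by ring
    _ ≤ 2 * ‖f.derivative.eval z‖ * (ε / 2) := by gcongr
    _ = _ := by ring

theorem partialFraction {n : ℕ} {f p : ℂ[X]} (hn : f.natDegree = n) (hn0 : 0 < n)
    {z : Fin n → ℂ} {w : ℂ}
    (hz : Function.Injective z) (hfz : ∀ j, f.eval (z j) = w) (hp : p.degree < f.degree)
    {x : ℂ} (hx : f.eval x ≠ w) :
    p.eval x / (f.eval x - w) = ∑ j, p.eval (z j) / f.derivative.eval (z j) / (x - z j) := by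
  have hf0 : f ≠ 0 := by rintro rfl; simp at hn; omega
  have hnod : f - C w = C f.leadingCoeff * Lagrange.nodal Finset.univ z := by
    have hcard : Finset.univ.card = n := Finset.card_fin n
    refine Polynomial.eq_of_degree_sub_lt_of_eval_index_eq (v := z) Finset.univ hz.injOn ?_ ?_
    · have hd : f.degree = n := by rw [degree_eq_natDegree hf0, hn]
      have hdw : (f - C w).degree = f.degree := degree_sub_C (by rw [hd]; exact_mod_cast hn0)
      have hlc : f.leadingCoeff ≠ 0 := leadingCoeff_ne_zero.2 hf0
      have hdn : (C f.leadingCoeff * Lagrange.nodal Finset.univ z).degree = n := by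
        rw [degree_C_mul hlc, Lagrange.degree_nodal, hcard]
      refine (degree_sub_lt_left (by rw [hdw, hdn, hd]) ?_ ?_).trans_eq ?_
      · intro h; rw [h, degree_zero, hd] at hdw; simp at hdw
      · rw [leadingCoeff_mul, leadingCoeff_C, Lagrange.nodal_monic.leadingCoeff, mul_one,
          leadingCoeff_sub_of_degree_lt]
        rw [hd]
        exact degree_C_le.trans_lt (by exact_mod_cast hn0)
      · rw [hdw, hd, hcard]
    · intro i _
      simp [hfz, Lagrange.eval_nodal_at_node]
  have hlc : f.leadingCoeff ≠ 0 := leadingCoeff_ne_zero.2 hf0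
  have hder (j) : f.derivative.eval (z j) =
      f.leadingCoeff * (Lagrange.nodalWeight Finset.univ z j)⁻¹ := by
    rw [Lagrange.nodalWeight_eq_eval_derivative_nodal (Finset.mem_univ j), inv_inv]
    have := congrArg (fun q ↦ (derivative q).eval (z j)) hnod
    simpa using this
  have hfx : f.eval x - w = f.leadingCoeff * (Lagrange.nodal Finset.univ z).eval x := by
    simpa using congrArg (eval x) hnod
  have hxz : ∀ j ∈ Finset.univ, x ≠ z j := fun j _ h ↦ hx (by rw [h, hfz])
  have hpi : p = Lagrange.interpolate Finset.univ z fun j ↦ p.eval (z j) :=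
    Lagrange.eq_interpolate hz.injOn (by
      rwa [Finset.card_fin, ← hn, ← degree_eq_natDegree hf0])
  have hne : (Lagrange.nodal Finset.univ z).eval x ≠ 0 := by
    intro h
    rw [h, mul_zero, sub_eq_zero] at hfx
    exact hx hfx
  conv_lhs => rw [hpi, Lagrange.eval_interpolate_not_at_node _ hxz, hfx]
  rw [mul_comm f.leadingCoeff, mul_div_mul_left _ _ hne, Finset.sum_div]
  refine Finset.sum_congr rfl fun j _ ↦ ?_
  rw [hder]
  have := Lagrange.nodalWeight_ne_zero hz.injOn (Finset.mem_univ j)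
  have := sub_ne_zero.2 (hxz j (Finset.mem_univ j))
  field_simp

/-- The integral of `h` along the segment from `a` to `b`. -/
noncomputable def segmentIntegral (a b : ℂ) (h : ℂ → ℂ) : ℂ :=
  ∫ t in (0 : ℝ)..1, (b - a) * h (a + t * (b - a))

theorem continuousOn_comp_segment {a b : ℂ} {h : ℂ → ℂ} (hh : ContinuousOn h (segment ℝ a b)) :
    ContinuousOn (fun t : ℝ ↦ h (a + t * (b - a))) (Set.uIcc 0 1) := by
  refine hh.comp (by fun_prop) fun t ht ↦ ?_
  rw [segment_eq_image']
  exact ⟨t, by simpa using ht, by simp⟩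

theorem intervalIntegrable_segment {a b : ℂ} {h : ℂ → ℂ} (hh : ContinuousOn h (segment ℝ a b)) :
    IntervalIntegrable (fun t : ℝ ↦ (b - a) * h (a + t * (b - a))) MeasureTheory.volume 0 1 :=
  (continuousOn_const.mul (continuousOn_comp_segment hh)).intervalIntegrable

theorem segment_mem {a b : ℂ} {t : ℝ} (ht : t ∈ Set.uIcc (0 : ℝ) 1) :
    a + t * (b - a) ∈ segment ℝ a b := by
  rw [segment_eq_image']
  exact ⟨t, by simpa using ht, by simp⟩

theorem segmentIntegral_congr {a b : ℂ} {g h : ℂ → ℂ} (hgh : Set.EqOn g h (segment ℝ a b)) :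
    segmentIntegral a b g = segmentIntegral a b h :=
  intervalIntegral.integral_congr fun t ht ↦ by simp only [hgh (segment_mem ht)]

theorem segmentIntegral_add {a b : ℂ} {g h : ℂ → ℂ} (hg : ContinuousOn g (segment ℝ a b))
    (hh : ContinuousOn h (segment ℝ a b)) :
    segmentIntegral a b (fun x ↦ g x + h x) = segmentIntegral a b g + segmentIntegral a b h := by
  rw [segmentIntegral, segmentIntegral, segmentIntegral, ← intervalIntegral.integral_add
    (intervalIntegrable_segment hg) (intervalIntegrable_segment hh)]
  simp only [mul_add]

theorem segmentIntegral_const_mul {a b : ℂ} (c : ℂ) (h : ℂ → ℂ) :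
    segmentIntegral a b (fun x ↦ c * h x) = c * segmentIntegral a b h := by
  rw [segmentIntegral, segmentIntegral, ← intervalIntegral.integral_const_mul]
  congr 1; ext t; ring

theorem segmentIntegral_sum {ι : Type*} {a b : ℂ} (s : Finset ι) {h : ι → ℂ → ℂ}
    (hh : ∀ i ∈ s, ContinuousOn (h i) (segment ℝ a b)) :
    segmentIntegral a b (fun x ↦ ∑ i ∈ s, h i x) = ∑ i ∈ s, segmentIntegral a b (h i) := by
  simp only [segmentIntegral]
  rw [← intervalIntegral.integral_finsetSum fun i hi ↦ intervalIntegrable_segment (hh i hi)]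
  simp only [Finset.mul_sum]

theorem norm_segmentIntegral_le {a b : ℂ} {h : ℂ → ℂ} {B : ℝ}
    (hB : ∀ x ∈ segment ℝ a b, ‖h x‖ ≤ B) : ‖segmentIntegral a b h‖ ≤ ‖b - a‖ * B := by
  have := intervalIntegral.norm_integral_le_of_norm_le_const (a := (0 : ℝ)) (b := 1)
    (f := fun t : ℝ ↦ (b - a) * h (a + t * (b - a))) (C := ‖b - a‖ * B) fun t ht ↦ by
      rw [norm_mul]
      gcongr
      exact hB _ (segment_mem (Set.uIoc_subset_uIcc ht))
  rwa [sub_zero, abs_one, mul_one] at this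

theorem segmentIntegral_eq_sub {a b : ℂ} {F h : ℂ → ℂ}
    (hF : ∀ x ∈ segment ℝ a b, HasDerivAt F (h x) x) (hh : ContinuousOn h (segment ℝ a b)) :
    segmentIntegral a b h = F b - F a := by
  have hd : ∀ t ∈ Set.uIcc (0 : ℝ) 1, HasDerivAt (fun t : ℝ ↦ F (a + t * (b - a)))
      ((b - a) * h (a + t * (b - a))) t := fun t ht ↦ by
    have h1 : HasDerivAt (fun t : ℝ ↦ a + t * (b - a)) (b - a) t := by
      have h2 : HasDerivAt (fun s : ℂ ↦ a + s * (b - a)) (b - a) t := by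
        simpa using ((hasDerivAt_id (t : ℂ)).mul_const (b - a)).const_add a
      exact h2.comp_ofReal
    exact (hF _ (segment_mem ht)).scomp t h1
  rw [segmentIntegral, intervalIntegral.integral_eq_sub_of_hasDerivAt hd
    (intervalIntegrable_segment hh)]
  simp

/-- If the positive moments of `p` against `f` vanish, the Cauchy transform near infinity reduces to
its leading term. -/
theorem segmentIntegral_cauchy {a b : ℂ} {f p : ℂ[X]}
    (hm : ∀ m, 1 ≤ m → segmentIntegral a b (f ^ m * p).eval = 0) {w : ℂ} {B : ℝ} (hBw : B < ‖w‖)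
    (hB : ∀ x ∈ segment ℝ a b, ‖f.eval x‖ ≤ B) :
    w * segmentIntegral a b (fun x ↦ p.eval x / (w - f.eval x)) = segmentIntegral a b p.eval := by
  have hne : ∀ x ∈ segment ℝ a b, w - f.eval x ≠ 0 := fun x hx h ↦ by
    rw [sub_eq_zero] at h
    exact absurd (hB x hx) (by rw [← h]; exact not_le.2 hBw)
  have hB0 : 0 ≤ B := (norm_nonneg _).trans (hB a (left_mem_segment ℝ a b))
  have hw : w ≠ 0 := norm_pos_iff.1 (hB0.trans_lt hBw)
  have hcont (m : ℕ) : ContinuousOn (fun x ↦ (f ^ m * p).eval x / (w - f.eval x))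
      (segment ℝ a b) := ContinuousOn.div (by fun_prop) (by fun_prop) hne
  let I (m : ℕ) := segmentIntegral a b (fun x ↦ (f ^ m * p).eval x / (w - f.eval x))
  have hstep (m : ℕ) : w * I m = segmentIntegral a b (f ^ m * p).eval + I (m + 1) := by
    rw [← segmentIntegral_const_mul, ← segmentIntegral_add (by fun_prop) (hcont _)]
    refine segmentIntegral_congr fun x hx ↦ ?_
    have := hne x hx
    simp only [eval_mul, eval_pow]
    field_simp
    ring
  have hpow (m : ℕ) : w ^ m * I 1 = I (m + 1) := by
    induction m with
    | zero => simp
    | succ m ih =>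
      rw [pow_succ', mul_assoc, ih, hstep, hm _ (by omega), zero_add]
  obtain ⟨D, hD⟩ : ∃ D, ∀ x ∈ segment ℝ a b, ‖(f ^ 1 * p).eval x / (w - f.eval x)‖ ≤ D := by
    have hcpt : IsCompact (segment ℝ a b) := by
      rw [segment_eq_image']
      exact isCompact_Icc.image (by fun_prop)
    exact hcpt.exists_bound_of_continuousOn (hcont 1)
  have hbound (m : ℕ) : ‖I 1‖ ≤ (B / ‖w‖) ^ m * (‖b - a‖ * D) := by
    have h1 : ‖I (m + 1)‖ ≤ ‖b - a‖ * (B ^ m * D) := by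
      refine norm_segmentIntegral_le fun x hx ↦ ?_
      have : (f ^ (m + 1) * p).eval x / (w - f.eval x) =
          f.eval x ^ m * ((f ^ 1 * p).eval x / (w - f.eval x)) := by
        simp only [eval_mul, eval_pow]; ring
      rw [this, norm_mul, norm_pow]
      exact mul_le_mul (pow_le_pow_left₀ (norm_nonneg _) (hB x hx) m) (hD x hx) (norm_nonneg _)
        (by positivity)
    rw [← hpow, norm_mul, norm_pow] at h1
    have hwpos : 0 < ‖w‖ ^ m := by positivity
    rw [div_pow, div_mul_eq_mul_div, le_div_iff₀ hwpos]
    linarith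
  have hI1 : I 1 = 0 := by
    have hlim : Tendsto (fun m ↦ (B / ‖w‖) ^ m * (‖b - a‖ * D)) atTop (𝓝 (0 * (‖b - a‖ * D))) :=
      (tendsto_pow_atTop_nhds_zero_of_lt_one (by positivity)
        ((div_lt_one (by positivity)).2 hBw)).mul_const _
    have := ge_of_tendsto' hlim hbound
    rw [zero_mul] at this
    exact norm_le_zero_iff.1 this
  have := hstep 0
  rw [zero_add, hI1, add_zero] at this
  simpa [I] using this

theorem div_sub_mem_slitPlane {a b z x : ℂ} (hz : ‖b - a‖ < ‖z - a‖) (hx : x ∈ segment ℝ a b) :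
    (x - z) / (a - z) ∈ Complex.slitPlane := by
  have haz : a - z ≠ 0 := by
    rw [← norm_pos_iff, norm_sub_rev]
    exact (norm_nonneg _).trans_lt hz
  have hxa : ‖x - a‖ ≤ ‖b - a‖ := by
    rw [segment_eq_image'] at hx
    obtain ⟨t, ht, rfl⟩ := hx
    rw [add_sub_cancel_left, norm_smul, Real.norm_of_nonneg ht.1]
    exact mul_le_of_le_one_left (norm_nonneg _) ht.2
  have : (x - z) / (a - z) = 1 + (x - a) / (a - z) := by field_simp; ring
  rw [this]
  refine Complex.mem_slitPlane_of_norm_lt_one ?_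
  rw [norm_div, div_lt_one (norm_pos_iff.2 haz), norm_sub_rev a z]
  exact hxa.trans_lt hz

theorem segmentIntegral_inv_sub {a b z : ℂ} (hz : ‖b - a‖ < ‖z - a‖) :
    segmentIntegral a b (fun x ↦ (x - z)⁻¹) = Complex.log ((b - z) / (a - z)) := by
  have haz : a - z ≠ 0 := by
    rw [← norm_pos_iff, norm_sub_rev]
    exact (norm_nonneg _).trans_lt hz
  have hslit : ∀ x ∈ segment ℝ a b, (x - z) / (a - z) ∈ Complex.slitPlane :=
    fun x hx ↦ div_sub_mem_slitPlane hz hx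
  have hxz : ∀ x ∈ segment ℝ a b, x - z ≠ 0 := fun x hx h ↦ by
    have := hslit x hx
    simp [h] at this
  rw [segmentIntegral_eq_sub (F := fun x ↦ Complex.log ((x - z) / (a - z)))]
  · simp [div_self haz]
  · intro x hx
    have h1 : HasDerivAt (fun x ↦ (x - z) / (a - z)) (1 / (a - z)) x :=
      ((hasDerivAt_id x).sub_const z).div_const _
    refine (h1.clog (hslit x hx)).congr_deriv ?_
    have := hxz x hx
    field_simp
  · exact ContinuousOn.inv₀ (by fun_prop) hxz

/-- The Cauchy transform of `p` against a polynomial `f`, in terms of the fibre of `f`. -/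
theorem exists_cauchy_eq_sum_log {a b : ℂ} {n : ℕ} {f : ℂ[X]} (hn : f.natDegree = n) (hn0 : 0 < n)
    (p : ℂ[X]) :
    ∃ T : ℂ[X], ∀ (z : Fin n → ℂ) (w : ℂ), Function.Injective z → (∀ j, f.eval (z j) = w) →
      (∀ j, ‖b - a‖ < ‖z j - a‖) → (∀ x ∈ segment ℝ a b, f.eval x ≠ w) →
      segmentIntegral a b (fun x ↦ p.eval x / (f.eval x - w)) = T.eval w +
        ∑ j, p.eval (z j) / f.derivative.eval (z j) * Complex.log ((b - z j) / (a - z j)) := by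
  have hf0 : f ≠ 0 := by rintro rfl; simp at hn; omega
  have hsmall (p : ℂ[X]) (hp : p.degree < f.degree) (z : Fin n → ℂ) (w : ℂ)
      (hz : Function.Injective z) (hfz : ∀ j, f.eval (z j) = w)
      (hza : ∀ j, ‖b - a‖ < ‖z j - a‖) (hx : ∀ x ∈ segment ℝ a b, f.eval x ≠ w) :
      segmentIntegral a b (fun x ↦ p.eval x / (f.eval x - w)) =
        ∑ j, p.eval (z j) / f.derivative.eval (z j) * Complex.log ((b - z j) / (a - z j)) := by
    rw [segmentIntegral_congr fun x hx' ↦ partialFraction hn hn0 hz hfz hp (hx x hx')]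
    rw [segmentIntegral_sum]
    · refine Finset.sum_congr rfl fun j _ ↦ ?_
      rw [← segmentIntegral_inv_sub (hza j), ← segmentIntegral_const_mul]
      rfl
    · intro j _
      refine ContinuousOn.div (by fun_prop) (by fun_prop) fun x hx' h ↦ hx x hx' ?_
      rw [sub_eq_zero.1 h, hfz]
  induction hd : p.natDegree using Nat.strong_induction_on generalizing p with
  | _ d ih =>
  rcases lt_or_ge p.degree f.degree with hlt | hle
  · exact ⟨0, fun z w hz hfz hza hx ↦ by rw [hsmall p hlt z w hz hfz hza hx]; simp⟩
  · have hquot : (p / f).natDegree < d := by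
      have := natDegree_le_natDegree hle
      rcases eq_or_ne (p / f) 0 with h0 | h0
      · rw [h0, natDegree_zero]
        omega
      · rw [← hd]
        refine natDegree_lt_natDegree h0 (degree_div_lt ?_ (natDegree_pos_iff_degree_pos.1 (by omega)))
        rintro rfl
        simp at h0
    obtain ⟨T, hT⟩ := ih _ hquot (p / f) rfl
    refine ⟨C (segmentIntegral a b (p / f).eval) + X * T, fun z w hz hfz hza hx ↦ ?_⟩
    have hne : ∀ x ∈ segment ℝ a b, f.eval x - w ≠ 0 := fun x hx' ↦ sub_ne_zero.2 (hx x hx')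
    have hcont (q : ℂ[X]) : ContinuousOn (fun x ↦ q.eval x / (f.eval x - w)) (segment ℝ a b) :=
      ContinuousOn.div (by fun_prop) (by fun_prop) hne
    have hpe (x) : p.eval x = f.eval x * (p / f).eval x + (p % f).eval x := by
      conv_lhs => rw [← EuclideanDomain.div_add_mod p f, eval_add, eval_mul]
    have hsplit : segmentIntegral a b (fun x ↦ p.eval x / (f.eval x - w)) =
        segmentIntegral a b (p / f).eval +
        w * segmentIntegral a b (fun x ↦ (p / f).eval x / (f.eval x - w)) +
        segmentIntegral a b (fun x ↦ (p % f).eval x / (f.eval x - w)) := by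
      have hcont' : ContinuousOn (fun x ↦ w * ((p / f).eval x / (f.eval x - w)))
          (segment ℝ a b) := continuousOn_const.mul (hcont _)
      have hp' : ContinuousOn (p / f).eval (segment ℝ a b) := by fun_prop
      have hsum : ContinuousOn (fun x ↦ (p / f).eval x + w * ((p / f).eval x / (f.eval x - w)))
          (segment ℝ a b) := hp'.add hcont'
      rw [← segmentIntegral_const_mul, ← segmentIntegral_add hp' hcont',
        ← segmentIntegral_add hsum (hcont _)]
      · refine segmentIntegral_congr fun x hx' ↦ ?_
        have := hne x hx'
        simp only [hpe]
        field_simp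
        ring
    rw [hsplit, hT z w hz hfz hza hx, hsmall _ (EuclideanDomain.mod_lt p hf0) z w hz hfz hza hx]
    simp only [hpe, hfz, add_div, add_mul, Finset.sum_add_distrib, mul_add, Finset.mul_sum,
      eval_add, eval_mul, eval_C, eval_X]
    simp only [mul_div_assoc, mul_assoc]
    ring

/-- Along a curve `z` lifting the positive reals through `f`, the logarithm of
`(b - z) / (a - z)` continues analytically and grows slowly towards the zero fibre. -/
theorem exists_branch_log {a b : ℂ} {f : ℂ[X]} (p : ℂ[X]) {z : ℝ → ℂ} (hz : Continuous z)
    (hfz : ∀ s, f.eval (z s) = Complex.exp s) (hf' : ∀ s, f.derivative.eval (z s) ≠ 0)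
    (ha : ∀ s, z s ≠ a) (hb : ∀ s, z s ≠ b) {s₁ : ℝ} (hs₁ : ∀ s ≥ s₁, ‖b - a‖ < ‖z s - a‖) :
    ∃ l : ℝ → ℂ, (∀ s, AnalyticAt ℝ l s) ∧
      (∀ s ≥ s₁, l s = Complex.log ((b - z s) / (a - z s))) ∧
      Tendsto (fun s : ℝ ↦ Complex.exp s * (p.eval (z s) / f.derivative.eval (z s) * l s))
        atBot (𝓝 0) := by
  have hf0 : f ≠ 0 := by
    rintro rfl
    simpa using hf' 0
  have ha' (s) : a - z s ≠ 0 := sub_ne_zero.2 (ha s).symm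
  have hb' (s) : b - z s ≠ 0 := sub_ne_zero.2 (hb s).symm
  have hza (s) : AnalyticAt ℝ z s := by
    refine analyticAt_of_lift (g := f.eval) hz.continuousAt hfz (analyticAt_ofReal_exp s)
      (AnalyticOnNhd.eval_polynomial f _ (Set.mem_univ _)) ?_
    rw [Polynomial.deriv]
    exact hf' s
  have hzd (s) : HasDerivAt z ((f.derivative.eval (z s))⁻¹ * Complex.exp s) s := by
    have := hasDerivAt_of_lift (g := f.eval) hz.continuousAt hfz (hasDerivAt_ofReal_exp s)
      (AnalyticOnNhd.eval_polynomial f _ (Set.mem_univ _)) (by rw [Polynomial.deriv]; exact hf' s)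
    rwa [Polynomial.deriv] at this
  set z' : ℝ → ℂ := fun s ↦ (f.derivative.eval (z s))⁻¹ * Complex.exp s with hz'
  let u : ℝ → ℂ := fun s ↦ (b - z s) / (a - z s)
  have hu0 (s) : u s ≠ 0 := div_ne_zero (hb' s) (ha' s)
  have hua (s) : AnalyticAt ℝ u s :=
    (analyticAt_const.sub (hza s)).div (analyticAt_const.sub (hza s)) (ha' s)
  have hud (s) : HasDerivAt u (u s * (z' s / (z s - b) - z' s / (z s - a))) s := by
    refine (((hzd s).const_sub b).div ((hzd s).const_sub a) (ha' s)).congr_deriv ?_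
    have h1 := ha' s
    have h2 := hb' s
    have h3 : z s - a ≠ 0 := sub_ne_zero.2 (ha s)
    have h4 : z s - b ≠ 0 := sub_ne_zero.2 (hb s)
    simp only [u]
    rw [← neg_sub a, ← neg_sub b]
    field_simp
    ring
  have huc : Continuous u := continuous_iff_continuousAt.2 fun s ↦ (hua s).continuousAt
  obtain ⟨l, hlc, hlu, hl₁⟩ := exists_continuous_log huc hu0 s₁
  have hld (s) : HasDerivAt l (z' s / (z s - b) - z' s / (z s - a)) s := by
    refine (hasDerivAt_of_lift hlc.continuousAt hlu (hud s) analyticAt_cexp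
      (by simp [Complex.exp_ne_zero])).congr_deriv ?_
    rw [Complex.deriv_exp, hlu, inv_mul_cancel_left₀ (hu0 s)]
  refine ⟨l, fun s ↦ analyticAt_of_lift hlc.continuousAt hlu (hua s) analyticAt_cexp
    (by simp [Complex.exp_ne_zero]), fun s hs ↦ ?_, ?_⟩
  · have hd (t) (ht : s₁ ≤ t) : HasDerivAt (fun t ↦ l t - Complex.log (u t)) 0 t := by
      refine ((hld t).sub ((hud t).clog_real
        (div_sub_mem_slitPlane (hs₁ t ht) (right_mem_segment ℝ a b)))).congr_deriv ?_
      rw [mul_div_cancel_left₀ _ (hu0 t), sub_self]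
    have := constant_of_has_deriv_right_zero (a := s₁) (b := s)
      (fun t ht ↦ (hd t ht.1).continuousAt.continuousWithinAt)
      (fun t ht ↦ (hd t ht.1).hasDerivWithinAt) s ⟨hs, le_rfl⟩
    rw [hl₁, sub_self, sub_eq_zero] at this
    exact this
  · have hw : Tendsto (fun s : ℝ ↦ Complex.exp s) atBot (𝓝 0) := by
      rw [tendsto_zero_iff_norm_tendsto_zero]
      simpa [Complex.norm_exp] using Real.tendsto_exp_atBot
    have hz'c (c : ℂ) (hc : ∀ s, z s ≠ c) : ∀ᶠ s in atBot, ‖z' s / (z s - c)‖ ≤ 2 := by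
      filter_upwards [hw.eventually (eventually_fiber_le_dist hf0 c)] with s hs
      have h1 := hs _ (hfz s)
      rw [hfz] at h1
      have h2 : 0 < ‖f.derivative.eval (z s)‖ := norm_pos_iff.2 (hf' s)
      have h3 : 0 < ‖z s - c‖ := norm_pos_iff.2 (sub_ne_zero.2 (hc s))
      rw [hz', norm_div, norm_mul, norm_inv, div_le_iff₀ h3, inv_mul_le_iff₀ h2]
      linarith
    obtain ⟨s₂, hs₂⟩ := eventually_atBot.1 ((hz'c b hb).and (hz'c a ha))
    have hl₂ : ∀ s ≤ s₂, ‖l s - l s₂‖ ≤ 4 * ‖s - s₂‖ := fun s hs ↦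
      (convex_Iic s₂).norm_image_sub_le_of_norm_hasDerivWithin_le
        (fun t _ ↦ (hld t).hasDerivWithinAt)
        (fun t ht ↦ (norm_sub_le _ _).trans (by
          have := hs₂ t ht
          linarith [this.1, this.2])) Set.self_mem_Iic hs
    have hlog : ∀ᶠ s in atBot, ‖l s‖ ≤ 5 * |s| := by
      filter_upwards [eventually_le_atBot s₂, eventually_le_atBot 0,
        eventually_le_atBot (-(‖l s₂‖ + 4 * |s₂|))] with s h1 h2 h3
      have h4 := hl₂ s h1
      have h5 : ‖s - s₂‖ ≤ |s| + |s₂| := abs_sub s s₂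
      have h6 := norm_sub_norm_le (l s) (l s₂)
      rw [abs_of_nonpos h2] at *
      linarith
    rw [Metric.tendsto_nhds]
    intro ε hε
    filter_upwards [hlog,
      hw.eventually (eventually_fiber_log_le hf0 p (show 0 < ε / 10 by positivity))] with s h1 h2
    have h3 := h2 _ (hfz s)
    rw [hfz, Complex.norm_exp, Complex.ofReal_re, Real.log_exp] at h3
    have h4 : 0 < ‖f.derivative.eval (z s)‖ := norm_pos_iff.2 (hf' s)
    rw [dist_zero_right, norm_mul, norm_mul, norm_div, Complex.norm_exp, Complex.ofReal_re]
    calc _ ≤ Real.exp s * (‖p.eval (z s)‖ / ‖f.derivative.eval (z s)‖ * (5 * |s|)) := by gcongr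
      _ = 5 * (‖p.eval (z s)‖ * (Real.exp s * |s|)) / ‖f.derivative.eval (z s)‖ := by ring
      _ ≤ 5 * (ε / 10 * ‖f.derivative.eval (z s)‖) / ‖f.derivative.eval (z s)‖ := by gcongr
      _ = ε / 2 := by field_simp; norm_num
      _ < ε := by linarith

theorem exists_rotation {S : Set ℂ} (hS : S.Finite) :
    ∃ u : ℂ, u ≠ 0 ∧ ∀ v ∈ S, ∀ s : ℝ, u * v ≠ Complex.exp s := by
  obtain ⟨k, hk⟩ := Set.Infinite.exists_notMem_finite
    (Set.infinite_range_of_injective Nat.cast_injective) (hS.image fun v : ℂ ↦ v.im / v.re)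
  obtain ⟨⟨k, rfl⟩, hk⟩ := hk
  have hk0 : (1 + k * Complex.I : ℂ) ≠ 0 := fun h ↦ by
    simpa using congrArg Complex.re h
  refine ⟨(1 + k * Complex.I)⁻¹, inv_ne_zero hk0, fun v hv s h ↦ hk ⟨v, hv, ?_⟩⟩
  rw [inv_mul_eq_iff_eq_mul₀ hk0, ← Complex.ofReal_exp] at h
  have hs := (Real.exp_pos s).ne'
  rw [h]
  beta_reduce
  rw [Complex.im_mul_ofReal, Complex.re_mul_ofReal, mul_div_mul_right _ _ hs]
  simp

theorem moment_vanishing_of_regular {a b : ℂ} {f p : ℂ[X]} (hdeg : 0 < f.natDegree)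
    (hf : ∀ z, f.derivative.eval z = 0 → ∀ s : ℝ, f.eval z ≠ Complex.exp s)
    (hfa : ∀ s : ℝ, f.eval a ≠ Complex.exp s) (hfb : ∀ s : ℝ, f.eval b ≠ Complex.exp s)
    (hm : ∀ m, 1 ≤ m → segmentIntegral a b (f ^ m * p).eval = 0) :
    segmentIntegral a b p.eval = 0 := by
  obtain ⟨z, hz, hfz, hinj⟩ := exists_branches hdeg hf
  have hf' (j s) : f.derivative.eval (z j s) ≠ 0 := fun h ↦ hf _ h s (hfz j s)
  obtain ⟨B, hB⟩ := (isCompact_closedBall a ‖b - a‖).exists_bound_of_continuousOn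
    (f := f.eval) (by fun_prop)
  have hseg : segment ℝ a b ⊆ Metric.closedBall a ‖b - a‖ :=
    (convex_closedBall a _).segment_subset (by simp) (by simp [dist_eq_norm])
  have hexp (s : ℝ) (hs : B ≤ s) : B < ‖Complex.exp s‖ := by
    rw [Complex.norm_exp, Complex.ofReal_re]
    linarith [Real.add_one_le_exp s]
  have hfar (j) (s : ℝ) (hs : s ≥ B) : ‖b - a‖ < ‖z j s - a‖ := by
    by_contra! h
    have := hB (z j s) (by simpa [dist_eq_norm] using h)
    rw [hfz] at this
    exact absurd this (not_le.2 (hexp s hs))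
  choose l hl hl' hl0 using fun j ↦ exists_branch_log (a := a) (b := b) p (hz j) (hfz j) (hf' j)
    (fun s h ↦ hfa s (h ▸ hfz j s)) (fun s h ↦ hfb s (h ▸ hfz j s)) (hfar j)
  obtain ⟨T, hT⟩ := exists_cauchy_eq_sum_log (a := a) (b := b) (f := f) rfl hdeg p
  set c := segmentIntegral a b p.eval
  let D : ℝ → ℂ := fun s ↦ c + (Complex.exp s * T.eval (Complex.exp s) +
    ∑ j, Complex.exp s * (p.eval (z j s) / f.derivative.eval (z j s) * l j s))
  have hDlarge (s : ℝ) (hs : B ≤ s) : D s = 0 := by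
    have hne : ∀ x ∈ segment ℝ a b, f.eval x ≠ Complex.exp s := fun x hx h ↦
      absurd (hB x (hseg hx)) (by rw [h]; exact not_le.2 (hexp s hs))
    have h1 := hT (fun j ↦ z j s) _ (hinj s) (fun j ↦ hfz j s) (fun j ↦ hfar j s hs) hne
    have h2 := segmentIntegral_cauchy hm (hexp s hs) fun x hx ↦ hB x (hseg hx)
    have h3 : segmentIntegral a b (fun x ↦ p.eval x / (f.eval x - Complex.exp s)) =
        -1 * segmentIntegral a b (fun x ↦ p.eval x / (Complex.exp s - f.eval x)) := by
      rw [← segmentIntegral_const_mul]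
      congr 1; ext x
      rw [← neg_sub, div_neg, neg_one_mul]
    simp only [D, ← Finset.mul_sum, ← mul_add, hl' _ s hs]
    rw [← h1, h3]
    linear_combination -h2
  have hza (j s) : AnalyticAt ℝ (z j) s := by
    refine analyticAt_of_lift (g := f.eval) (hz j).continuousAt (hfz j) (analyticAt_ofReal_exp s)
      (AnalyticOnNhd.eval_polynomial f _ (Set.mem_univ _)) ?_
    rw [Polynomial.deriv]
    exact hf' j s
  have hpoly (q : ℂ[X]) {y : ℝ → ℂ} {s : ℝ} (hy : AnalyticAt ℝ y s) :
      AnalyticAt ℝ (fun s ↦ q.eval (y s)) s :=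
    AnalyticAt.comp (g := q.eval) (AnalyticAt.restrictScalars (𝕜 := ℝ) (𝕜' := ℂ)
      (AnalyticOnNhd.eval_polynomial q _ (Set.mem_univ (y s)))) hy
  have hDan : AnalyticOnNhd ℝ D Set.univ := fun s _ ↦ by
    refine analyticAt_const.add (((analyticAt_ofReal_exp s).mul
      (hpoly T (analyticAt_ofReal_exp s))).add
      (Finset.analyticAt_fun_sum _ fun j _ ↦ (analyticAt_ofReal_exp s).mul ?_))
    exact ((hpoly p (hza j s)).div (hpoly _ (hza j s)) (hf' j s)).mul (hl j s)
  have hD : D = fun _ ↦ 0 := hDan.eq_of_eventuallyEq (z₀ := B + 1) analyticOnNhd_const (by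
    filter_upwards [eventually_ge_nhds (show B < B + 1 by linarith)] with s hs
    exact hDlarge s hs)
  have hw : Tendsto (fun s : ℝ ↦ Complex.exp s) atBot (𝓝 0) := by
    rw [tendsto_zero_iff_norm_tendsto_zero]
    simpa [Complex.norm_exp] using Real.tendsto_exp_atBot
  have hlim : Tendsto D atBot (𝓝 (c + (0 * T.eval 0 + ∑ _j : Fin f.natDegree, 0))) :=
    tendsto_const_nhds.add ((hw.mul ((T.continuous.tendsto 0).comp hw)).add
      (tendsto_finsetSum _ fun j _ ↦ hl0 j))
  rw [hD] at hlim
  have := tendsto_nhds_unique hlim tendsto_const_nhds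
  rwa [Finset.sum_const_zero, zero_mul, add_zero, add_zero] at this

/-- If all positive moments of `p` against a nonzero polynomial `f` vanish, so does the zeroth. -/
theorem moment_vanishing {a b : ℂ} {f p : ℂ[X]} (hf : f ≠ 0)
    (hm : ∀ m, 1 ≤ m → segmentIntegral a b (f ^ m * p).eval = 0) :
    segmentIntegral a b p.eval = 0 := by
  have hscale (k : ℂ) (q : ℂ[X]) :
      segmentIntegral a b (C k * q).eval = k * segmentIntegral a b q.eval := by
    rw [← segmentIntegral_const_mul]
    congr 1; ext x; simp
  rcases Nat.eq_zero_or_pos f.natDegree with h0 | hdeg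
  · rw [eq_C_of_natDegree_eq_zero h0] at hm hf
    have h1 := hm 1 le_rfl
    rw [pow_one, hscale] at h1
    exact (mul_eq_zero.1 h1).resolve_left fun h ↦ hf (by rw [h, C_0])
  · have hd0 : f.derivative ≠ 0 := fun h ↦
      hdeg.ne' (Polynomial.derivative_eq_zero.1 h)
    have hfin : (f.eval '' ({a, b} ∪ {x | f.derivative.IsRoot x})).Finite :=
      ((Set.toFinite {a, b}).union (finite_setOfPred_isRoot hd0)).image _
    obtain ⟨u, hu, huS⟩ := exists_rotation hfin
    refine moment_vanishing_of_regular (f := C u * f) ?_ (fun z hz s ↦ ?_) (fun s ↦ ?_)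
      (fun s ↦ ?_) fun m hm' ↦ ?_
    · rwa [natDegree_C_mul hu]
    · rw [eval_mul, eval_C]
      refine huS _ ⟨z, Or.inr ?_, rfl⟩ s
      rw [derivative_C_mul, eval_mul, eval_C] at hz
      exact (mul_eq_zero.1 hz).resolve_left hu
    · rw [eval_mul, eval_C]
      exact huS _ ⟨a, by simp, rfl⟩ s
    · rw [eval_mul, eval_C]
      exact huS _ ⟨b, by simp, rfl⟩ s
    · rw [mul_pow, mul_assoc, ← C_pow, hscale, hm m hm', mul_zero]

theorem exists_derivative_eq (h : ℂ[X]) : ∃ F : ℂ[X], derivative F = h := by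
  induction h using Polynomial.induction_on' with
  | add p q hp hq =>
    obtain ⟨F, rfl⟩ := hp
    obtain ⟨G, rfl⟩ := hq
    exact ⟨F + G, derivative_add⟩
  | monomial n c =>
    refine ⟨monomial (n + 1) (c / (n + 1)), ?_⟩
    have : (n + 1 : ℂ) ≠ 0 := by exact_mod_cast n.succ_ne_zero
    rw [derivative_monomial]
    congr 1
    push_cast
    field_simp

theorem segmentIntegral_derivative (a b : ℂ) (F : ℂ[X]) :
    segmentIntegral a b (derivative F).eval = F.eval b - F.eval a :=
  segmentIntegral_eq_sub (fun x _ ↦ F.hasDerivAt x) (by fun_prop)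

theorem mem_Nq {a b : ℂ} {q f : ℂ[X]} :
    f ∈ Nq a b q ↔ segmentIntegral a b (f * q).eval = 0 := by
  constructor
  · rintro ⟨F, hF, hFe⟩
    rw [← hF, segmentIntegral_derivative, hFe]
  · intro h
    obtain ⟨F, hF⟩ := exists_derivative_eq (f * q)
    exact ⟨F, hF, by rw [← segmentIntegral_derivative, hF, h]⟩

theorem mem_colonSub_Nq {a b : ℂ} {q u f : ℂ[X]} :
    f ∈ colonSub (A := ℂ[X]) (Nq a b q) u ↔ segmentIntegral a b (f * (u * q)).eval = 0 := by
  have h : f ∈ colonSub (A := ℂ[X]) (Nq a b q) u ↔ f • u ∈ Nq a b q := Iff.rfl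
  rw [h, mem_Nq, smul_eq_mul, mul_assoc]

/-- A polynomial orthogonal to all polynomials on a nondegenerate segment is zero. -/
theorem eq_zero_of_forall_segmentIntegral {a b : ℂ} (hab : a ≠ b) {h : ℂ[X]}
    (hh : ∀ f : ℂ[X], segmentIntegral a b (f * h).eval = 0) : h = 0 := by
  have hba : b - a ≠ 0 := sub_ne_zero.2 hab.symm
  let k : ℂ[X] := h.comp (C a + X * C (b - a))
  have hk (t : ℂ) : k.eval t = h.eval (a + t * (b - a)) := by simp [k]
  let f : ℂ[X] := (k.map (starRingEnd ℂ)).comp ((X - C a) * C (b - a)⁻¹)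
  have hf (t : ℝ) : f.eval (a + t * (b - a)) = starRingEnd ℂ (k.eval (t : ℂ)) := by
    have : (a + t * (b - a) - a) * (b - a)⁻¹ = starRingEnd ℂ (t : ℂ) := by
      rw [Complex.conj_ofReal]
      field_simp
      ring
    simp only [f, eval_comp, eval_mul, eval_sub, eval_X, eval_C]
    rw [this, eval_map_apply]
  have hint : ∫ t in (0 : ℝ)..1, ‖k.eval (t : ℂ)‖ ^ 2 = 0 := by
    have h1 := hh f
    rw [segmentIntegral, intervalIntegral.integral_const_mul] at h1
    have h2 := (mul_eq_zero.1 h1).resolve_left hba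
    rw [← Complex.ofReal_inj, ← intervalIntegral.integral_ofReal, Complex.ofReal_zero, ← h2]
    refine intervalIntegral.integral_congr fun t _ ↦ ?_
    simp only [eval_mul, hf, ← hk, Complex.conj_mul', Complex.ofReal_pow]
  have hzero : ∀ t ∈ Set.Icc (0 : ℝ) 1, k.eval (t : ℂ) = 0 := by
    by_contra! hne
    obtain ⟨t, ht, htne⟩ := hne
    refine (intervalIntegral.integral_pos (f := fun t : ℝ ↦ ‖k.eval (t : ℂ)‖ ^ 2) zero_lt_one
      (by fun_prop) (fun _ _ ↦ by positivity) ⟨t, ht, by positivity⟩).ne' hint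
  have hk0 : k = 0 := by
    refine eq_zero_of_infinite_isRoot k (Set.Infinite.mono ?_
      ((Set.Icc_infinite (zero_lt_one (α := ℝ))).image Complex.ofReal_injective.injOn))
    rintro _ ⟨t, ht, rfl⟩
    exact hzero t ht
  refine Polynomial.funext fun x ↦ ?_
  have := hk ((x - a) / (b - a))
  rw [div_mul_cancel₀ _ hba, add_sub_cancel, hk0, eval_zero] at this
  rw [← this, eval_zero]

theorem stmt19 (a b : ℂ) (hab : a ≠ b) (q : Polynomial ℂ) (hq : q ≠ 0) :
    sigmaSet (A := Polynomial ℂ) (M := Polynomial ℂ) (Nq a b q) = {0} ∧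
    tauSet (A := Polynomial ℂ) (M := Polynomial ℂ) (Nq a b q) =
      ((Nq a b q : Set (Polynomial ℂ)))ᶜ ∪ {0} := by
  have hzero (f : ℂ[X]) : segmentIntegral a b (f * (0 * q)).eval = 0 := by
    simp [segmentIntegral]
  have hpow (f g : ℂ[X]) (h0 : segmentIntegral a b (g * q).eval ≠ 0)
      (hf : ∀ m : ℕ, 1 ≤ m → segmentIntegral a b (f ^ m * (g * q)).eval = 0) : f = 0 := by
    by_contra hne
    exact h0 (moment_vanishing hne hf)
  constructor
  · ext u
    simp only [sigmaSet, Set.mem_ofPred_eq, Set.mem_singleton_iff]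
    constructor
    · intro hu
      have hideal (f g : ℂ[X]) (hf : segmentIntegral a b (f * (u * q)).eval = 0) :
          segmentIntegral a b (g * (f * (u * q))).eval = 0 := by
        rw [← mul_assoc]
        exact mem_colonSub_Nq.1 (hu f (mem_colonSub_Nq.2 hf) g).1
      obtain ⟨f, hf0, hf⟩ : ∃ f : ℂ[X], f ≠ 0 ∧
          segmentIntegral a b (f * (u * q)).eval = 0 := by
        by_cases h1 : segmentIntegral a b (u * q).eval = 0
        · exact ⟨1, one_ne_zero, by rwa [one_mul]⟩
        · set c := segmentIntegral a b (u * q).eval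
          set d := segmentIntegral a b (X * (u * q)).eval
          refine ⟨X - C (d / c), X_sub_C_ne_zero _, ?_⟩
          have h2 : segmentIntegral a b ((X - C (d / c)) * (u * q)).eval = d + -(d / c) * c := by
            rw [← segmentIntegral_const_mul, ← segmentIntegral_add (by fun_prop) (by fun_prop)]
            congr 1; ext x
            simp only [eval_mul, eval_sub, eval_X, eval_C]
            ring
          rw [h2]
          field_simp
          ring
      have h3 := eq_zero_of_forall_segmentIntegral hab fun g ↦ hideal f g hf
      exact (mul_eq_zero.1 ((mul_eq_zero.1 h3).resolve_left hf0)).resolve_right hq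
    · rintro rfl f - g
      exact ⟨mem_colonSub_Nq.2 (hzero _), mem_colonSub_Nq.2 (hzero _)⟩
  · ext u
    simp only [tauSet, Set.mem_ofPred_eq, Set.mem_union, Set.mem_compl_iff, SetLike.mem_coe,
      Set.mem_singleton_iff, mem_Nq]
    constructor
    · intro hu
      by_contra! h
      obtain ⟨h1, h2⟩ := h
      refine mul_ne_zero h2 hq (eq_zero_of_forall_segmentIntegral hab fun f ↦ ?_)
      obtain ⟨N, -, hN⟩ := hu 1 (fun m _ ↦ mem_colonSub_Nq.2 (by rwa [one_pow, one_mul])) f 1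
      have := mem_colonSub_Nq.1 (hN N le_rfl)
      rwa [one_pow, mul_one, mul_one] at this
    · rintro (hu | rfl)
      · intro f hf g h
        refine ⟨1, le_rfl, fun m hm ↦ ?_⟩
        rw [hpow f u hu fun m hm ↦ mem_colonSub_Nq.1 (hf m hm), zero_pow (by omega), mul_zero,
          zero_mul]
        exact Submodule.zero_mem _
      · exact fun f _ g h ↦ ⟨1, le_rfl, fun m _ ↦ mem_colonSub_Nq.2 (hzero _)⟩
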